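/- arXiv:1206.6731 — 4 statements merged into one kernel-verified Lean document; each statement's English description precedes it below -/
import Mathlib

section
/- For every integer k ≥ 1, the ideal I^k has linear quotients with respect to the increasing reverse lexicographic order of its minimal monomial generators: for every m ∈ G(I^k), the colon ideal I^k_{<revlex m} : (m) equals the ideal generated by the variables {x_j : j ∈ set(m)}. -/
open MvPolynomial Finset

/-- A monomial in `n` variables, recorded by its exponent vector
(index `i : Fin n` corresponds to the variable `x_{i+1}` of the paper). -/
abbrev Mon (n : ℕ) := Fin n →₀ ℕ

/-- The exponent vector of the single variable `x_{j+1}` (`0`-indexed `j`). -/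
noncomputable def sing (n j : ℕ) : Mon n :=
  Finsupp.onFinset Finset.univ (fun i => if (i : ℕ) = j then 1 else 0)
    (fun a _ => Finset.mem_univ a)

/-- Total degree of a monomial. -/
def deg {n : ℕ} (m : Mon n) : ℕ := m.sum fun _ e => e

/-- `m₁ <_lex m₂` for the lexicographic order with `x_1 > x_2 > ⋯ > x_n`. -/
def lexLT {n : ℕ} (m₁ m₂ : Mon n) : Prop :=
  ∃ i : Fin n, (∀ j : Fin n, j < i → m₁ j = m₂ j) ∧ m₁ i < m₂ i

def lexLE {n : ℕ} (m₁ m₂ : Mon n) : Prop := m₁ = m₂ ∨ lexLT m₁ m₂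

/-- `m₁ <_revlex m₂` : the increasing reverse lexicographic order. -/
def revLT {n : ℕ} (m₁ m₂ : Mon n) : Prop :=
  ∃ s : Fin n, (∀ i : Fin n, s < i → m₁ i = m₂ i) ∧ m₂ s < m₁ s

def revLE {n : ℕ} (m₁ m₂ : Mon n) : Prop := m₁ = m₂ ∨ revLT m₁ m₂

/-- `min(m)`: the (0-indexed) smallest index in the support of `m`. -/
noncomputable def minIdx {n : ℕ} (m : Mon n) : ℕ := sInf {j : ℕ | ∃ h : j < n, m ⟨j, h⟩ ≠ 0}

/-- `m̄`: the part of `m` supported in the variables `x_1, …, x_l`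
(0-indexed: indices `< l`). -/
noncomputable def lowPart {n : ℕ} (l : ℕ) (m : Mon n) : Mon n :=
  m.filter fun i => (i : ℕ) < l

/-- `m̃`: the part of `m` supported in the variables `x_{l+1}, …, x_n`
(0-indexed: indices `≥ l`). -/
noncomputable def highPart {n : ℕ} (l : ℕ) (m : Mon n) : Mon n :=
  m.filter fun i => l ≤ (i : ℕ)

/-- The exponent vector of `u = x_1 · x_{l+1}^{a_{l+1}} ⋯ x_n^{a_n}`, where
`a j` (for `l ≤ j < n`, 0-indexed) is the exponent of `x_{j+1}`. -/
noncomputable def uVec (n l : ℕ) (a : ℕ → ℕ) : Mon n :=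
  sing n 0 + ∑ j ∈ Finset.Ico l n, a j • sing n j

/-- The exponent vector of `v = x_l · x_n^{d-1}`. -/
noncomputable def vVec (n l d : ℕ) : Mon n :=
  sing n (l - 1) + (d - 1) • sing n (n - 1)

/-- The lexsegment `L(u,v)`: monomials `w` of degree `d` with `u ≥_lex w ≥_lex v`. -/
def lexSeg (n l d : ℕ) (a : ℕ → ℕ) : Set (Mon n) :=
  { w | deg w = d ∧ lexLE (vVec n l d) w ∧ lexLE w (uVec n l a) }

/-- The lexsegment ideal `I = (L(u,v)) ⊆ K[x_1,…,x_n]`. -/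
noncomputable def lexIdeal (n l d : ℕ) (a : ℕ → ℕ) (K : Type*) [Field K] :
    Ideal (MvPolynomial (Fin n) K) :=
  Ideal.span ((fun w => monomial w (1 : K)) '' lexSeg n l d a)

/-- `G(J)`: the minimal monomial generators of a monomial ideal `J`, i.e.
monomials `m ∈ J` with `m / x_i ∉ J` for every `i ∈ supp m`. -/
def minGens {n : ℕ} (K : Type*) [Field K] (J : Ideal (MvPolynomial (Fin n) K)) :
    Set (Mon n) :=
  { m | monomial m (1 : K) ∈ J ∧
      ∀ i ∈ m.support, monomial (m - Finsupp.single i 1) (1 : K) ∉ J }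

/-- `J_{<revlex m}`: the ideal generated by all `z ∈ G(J)` with `z <_revlex m`. -/
noncomputable def idealBelow {n : ℕ} (K : Type*) [Field K]
    (J : Ideal (MvPolynomial (Fin n) K)) (m : Mon n) : Ideal (MvPolynomial (Fin n) K) :=
  Ideal.span ((fun z => monomial z (1 : K)) '' { z | z ∈ minGens K J ∧ revLT z m })

/-- `set(m) = {j : x_j · m ∈ J_{<revlex m}}` (0-indexed). -/
def setOfGen {n : ℕ} (K : Type*) [Field K] (J : Ideal (MvPolynomial (Fin n) K))
    (m : Mon n) : Set ℕ :=
  { j | j < n ∧ monomial (m + sing n j) (1 : K) ∈ idealBelow K J m }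

/-- The order `≺` on monomials: compare first the degree of the part supported in
`x_1,…,x_l`, then `<_lex`. -/
def precLT {n : ℕ} (l : ℕ) (m₁ m₂ : Mon n) : Prop :=
  deg (lowPart l m₁) < deg (lowPart l m₂) ∨
    (deg (lowPart l m₁) = deg (lowPart l m₂) ∧ lexLT m₁ m₂)

/-- `w = g(z)`: `w` is the `<_revlex`-smallest minimal monomial generator of `J`
dividing the monomial `z` (the value of the decomposition function). -/
def isDecompOf {n : ℕ} (K : Type*) [Field K] (J : Ideal (MvPolynomial (Fin n) K))
    (z w : Mon n) : Prop :=
  w ∈ minGens K J ∧ w ≤ z ∧ ∀ w' ∈ minGens K J, w' ≤ z → revLE w w'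

/-- Degree in the variables of index `< l`. -/
def lowDeg {n : ℕ} (l : ℕ) (m : Mon n) : ℕ := ∑ i : Fin n, if (i : ℕ) < l then m i else 0

/-- Sums of `k` elements of `L`. -/
def sums {n : ℕ} (L : Set (Mon n)) : ℕ → Set (Mon n)
  | 0 => {0}
  | k + 1 => { x | ∃ w ∈ L, ∃ p ∈ sums L k, x = w + p }

theorem deg_eq {n : ℕ} (m : Mon n) : deg m = ∑ i, m i := by
  unfold deg
  exact Finsupp.sum_fintype _ _ (fun _ => rfl)

theorem deg_add {n : ℕ} (a b : Mon n) : deg (a + b) = deg a + deg b := by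
  simp [deg_eq, Finset.sum_add_distrib]

theorem lowDeg_add {n : ℕ} (l : ℕ) (a b : Mon n) :
    lowDeg l (a + b) = lowDeg l a + lowDeg l b := by
  unfold lowDeg
  rw [← Finset.sum_add_distrib]
  apply Finset.sum_congr rfl
  intro i _
  split_ifs <;> simp

theorem deg_single {n : ℕ} (i : Fin n) : deg (Finsupp.single i 1 : Mon n) = 1 := by
  unfold deg
  simp

theorem lowDeg_single {n : ℕ} (l : ℕ) (i : Fin n) :
    lowDeg l (Finsupp.single i 1 : Mon n) = if (i : ℕ) < l then 1 else 0 := by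
  unfold lowDeg
  rw [Finset.sum_eq_single i]
  · simp
  · intro b _ hb
    simp [Finsupp.single_apply, hb.symm]
  · simp

theorem lowDeg_pos {n : ℕ} {l : ℕ} {m : Mon n} (h : 1 ≤ lowDeg l m) :
    ∃ i : Fin n, (i : ℕ) < l ∧ 0 < m i := by
  by_contra! hc
  have : lowDeg l m = 0 := by
    unfold lowDeg
    apply Finset.sum_eq_zero
    intro i _
    split_ifs with hi
    · have := hc i hi
      omega
    · rfl
  omega

theorem lowDeg_ge {n : ℕ} {l : ℕ} {m : Mon n} (i : Fin n) (hi : (i : ℕ) < l) :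
    m i ≤ lowDeg l m := by
  unfold lowDeg
  have := Finset.single_le_sum (f := fun i : Fin n => if (i : ℕ) < l then m i else 0)
    (fun _ _ => Nat.zero_le _) (Finset.mem_univ i)
  simpa [hi] using this

theorem lexLT_trans {n : ℕ} {a b c : Mon n} (h1 : lexLT a b) (h2 : lexLT b c) : lexLT a c := by
  obtain ⟨i, hi, hi'⟩ := h1
  obtain ⟨j, hj, hj'⟩ := h2
  rcases lt_trichotomy i j with h | h | h
  · exact ⟨i, fun t ht => (hi t ht).trans (hj t (ht.trans h)), hj i h ▸ hi'⟩
  · subst h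
    exact ⟨i, fun t ht => (hi t ht).trans (hj t ht), hi'.trans hj'⟩
  · exact ⟨j, fun t ht => (hi t (ht.trans h)).trans (hj t ht), hi j h ▸ hj'⟩

theorem sing_apply (n j : ℕ) (i : Fin n) : sing n j i = if (i : ℕ) = j then 1 else 0 := rfl

theorem sing_eq {n : ℕ} (i : Fin n) : sing n i = Finsupp.single i 1 := by
  ext t
  rw [sing_apply, Finsupp.single_apply]
  simp [Fin.ext_iff, eq_comm]

theorem vVec_apply (n l d : ℕ) (i : Fin n) : vVec n l d i =
    (if (i : ℕ) = l - 1 then 1 else 0) + (d - 1) * (if (i : ℕ) = n - 1 then 1 else 0) := by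
  simp [vVec, sing_apply]

theorem vVec_deg {n l d : ℕ} (hd : 2 ≤ d) (hl2 : 2 ≤ l) (hln : l ≤ n - 1) :
    deg (vVec n l d) = d := by
  have h1 : vVec n l d = Finsupp.single (⟨l - 1, by omega⟩ : Fin n) 1
      + (d - 1) • Finsupp.single (⟨n - 1, by omega⟩ : Fin n) 1 := by
    rw [← sing_eq, ← sing_eq]; rfl
  rw [h1, deg_add, deg_single, Finsupp.smul_single, smul_eq_mul, mul_one]
  unfold deg
  rw [Finsupp.sum_single_index rfl]
  omega

theorem v_le_iff {n l d : ℕ} (hd : 2 ≤ d) (hl2 : 2 ≤ l) (hln : l ≤ n - 1) (w : Mon n)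
    (hw : deg w = d) : lexLE (vVec n l d) w ↔ 1 ≤ lowDeg l w := by
  have hv := vVec_apply n l d
  have hL : vVec n l d (⟨l - 1, by omega⟩ : Fin n) = 1 := by
    rw [hv]
    simp
    omega
  constructor
  · rintro (rfl | ⟨i, hi, hi'⟩)
    · have := lowDeg_ge (m := vVec n l d) (⟨l - 1, by omega⟩ : Fin n) (l := l) (by simp; omega)
      omega
    · by_cases h : (i : ℕ) < l
      · have := lowDeg_ge (m := w) i h
        omega
      · have h2 := hi (⟨l - 1, by omega⟩ : Fin n) (by rw [Fin.lt_def]; simp; omega)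
        have := lowDeg_ge (m := w) (⟨l - 1, by omega⟩ : Fin n) (l := l) (by simp; omega)
        omega
  · intro h
    by_cases hne : vVec n l d = w
    · exact Or.inl hne
    right
    have hex : ∃ t : ℕ, ∃ ht : t < n, vVec n l d ⟨t, ht⟩ ≠ w ⟨t, ht⟩ := by
      by_contra! hc
      exact hne (Finsupp.ext fun i => hc i i.2)
    classical
    obtain ⟨ht, hdiff⟩ := Nat.find_spec hex
    have hmin := fun m hm => Nat.find_min hex (m := m) hm
    generalize Nat.find hex = t at *
    have hagree : ∀ j : Fin n, j < (⟨t, ht⟩ : Fin n) → vVec n l d j = w j := by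
      intro j hj
      by_contra hc
      exact hmin j hj ⟨j.2, hc⟩
    refine ⟨⟨t, ht⟩, hagree, ?_⟩
    by_cases hlast : t = n - 1
    · exfalso
      have hdv := vVec_deg hd hl2 hln
      have hdv := hdv.trans hw.symm
      rw [deg_eq, deg_eq, ← Finset.add_sum_erase _ _ (Finset.mem_univ (⟨t, ht⟩ : Fin n)),
        ← Finset.add_sum_erase Finset.univ (fun i => w i)
          (Finset.mem_univ (⟨t, ht⟩ : Fin n))] at hdv
      have : ∑ x ∈ Finset.univ.erase (⟨t, ht⟩ : Fin n), vVec n l d x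
          = ∑ x ∈ Finset.univ.erase (⟨t, ht⟩ : Fin n), w x := by
        apply Finset.sum_congr rfl
        intro x hx
        apply hagree
        have hx1 := (Finset.mem_erase.1 hx).1
        have hx2 := x.2
        have : (x : ℕ) ≠ t := fun h => hx1 (Fin.ext h)
        rw [Fin.lt_def]
        simp
        omega
      omega
    · have hvt := hv ⟨t, ht⟩
      simp only [hlast, if_false, mul_zero, add_zero] at hvt
      by_cases htl : t = l - 1
      · rw [if_pos htl] at hvt
        obtain ⟨i, hi, hip⟩ := lowDeg_pos h
        rcases Nat.lt_or_ge (i : ℕ) t with h3 | h3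
        · have h4 := hagree i h3
          have h5 := hv i
          rw [if_neg (by omega), if_neg (by omega)] at h5
          omega
        · have : i = ⟨t, ht⟩ := Fin.ext (by simp; omega)
          subst this
          omega
      · rw [if_neg htl] at hvt
        omega

theorem exch_exists {n : ℕ} (w : Mon n) (i s : Fin n) (hw : 0 < w i) :
    ∃ w' : Mon n, w' + Finsupp.single i 1 = w + Finsupp.single s 1 := by
  refine ⟨w - Finsupp.single i 1 + Finsupp.single s 1, ?_⟩
  rw [add_right_comm, tsub_add_cancel_of_le]
  rw [Finsupp.single_le_iff]
  exact hw

theorem lexSeg_exch {n l d : ℕ} {a : ℕ → ℕ} (hd : 2 ≤ d) (hl2 : 2 ≤ l) (hln : l ≤ n - 1)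
    {w w' : Mon n} (hw : w ∈ lexSeg n l d a) {i s : Fin n} (his : i < s)
    (he : w' + Finsupp.single i 1 = w + Finsupp.single s 1)
    (hc : (s : ℕ) < l ∨ l ≤ (i : ℕ) ∨ 2 ≤ lowDeg l w) : w' ∈ lexSeg n l d a := by
  obtain ⟨h1, h2, h3⟩ := hw
  rw [v_le_iff hd hl2 hln w h1] at h2
  have hdeg : deg w' = d := by
    have := congrArg deg he
    rw [deg_add, deg_add, deg_single, deg_single] at this
    omega
  refine ⟨hdeg, (v_le_iff hd hl2 hln w' hdeg).2 ?_, ?_⟩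
  · have := congrArg (lowDeg l) he
    rw [lowDeg_add, lowDeg_add, lowDeg_single, lowDeg_single] at this
    have his' : (i : ℕ) < s := his
    split_ifs at this <;> omega
  · have hlt : lexLT w' w := by
      refine ⟨i, fun j hj => ?_, ?_⟩
      · have := DFunLike.congr_fun he j
        simpa [Finsupp.single_apply, hj.ne', (hj.trans his).ne'] using this
      · have := DFunLike.congr_fun he i
        simp [Finsupp.single_apply, his.ne'] at this
        omega
    right
    rcases h3 with rfl | h3
    · exact hlt
    · exact lexLT_trans hlt h3

section
variable {n l d : ℕ} {a : ℕ → ℕ}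

theorem sums_deg {k : ℕ} : ∀ {m : Mon n}, m ∈ sums (lexSeg n l d a) k → deg m = k * d := by
  induction k with
  | zero => rintro m rfl; simp [deg]
  | succ k ih =>
    rintro m ⟨w, hw, p, hp, rfl⟩
    rw [deg_add, ih hp, hw.1]
    ring

theorem sums_low (hd : 2 ≤ d) (hl2 : 2 ≤ l) (hln : l ≤ n - 1) {k : ℕ} :
    ∀ {m : Mon n}, m ∈ sums (lexSeg n l d a) k → k ≤ lowDeg l m := by
  induction k with
  | zero => intros; omega
  | succ k ih =>
    rintro m ⟨w, hw, p, hp, rfl⟩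
    have := (v_le_iff hd hl2 hln w hw.1).1 hw.2.1
    have := ih hp
    rw [lowDeg_add]
    omega

theorem sums_exch (hd : 2 ≤ d) (hl2 : 2 ≤ l) (hln : l ≤ n - 1) {i s : Fin n} (his : i < s)
    (hc : (s : ℕ) < l ∨ l ≤ (i : ℕ)) {k : ℕ} :
    ∀ {m : Mon n}, m ∈ sums (lexSeg n l d a) k → 0 < m i →
      ∃ m' ∈ sums (lexSeg n l d a) k, m' + Finsupp.single i 1 = m + Finsupp.single s 1 := by
  induction k with
  | zero => rintro m rfl h; simp at h
  | succ k ih =>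
    rintro m ⟨w, hw, p, hp, rfl⟩ h
    by_cases hwi : 0 < w i
    · obtain ⟨w', he⟩ := exch_exists w i s hwi
      refine ⟨w' + p, ⟨w', lexSeg_exch hd hl2 hln hw his he (by tauto), p, hp, rfl⟩, ?_⟩
      rw [add_right_comm, he, add_right_comm]
    · have hpi : 0 < p i := by
        rw [Finsupp.add_apply] at h
        omega
      obtain ⟨p', hp', he⟩ := ih hp hpi
      refine ⟨w + p', ⟨w, hw, p', hp', rfl⟩, ?_⟩
      rw [add_assoc, he, add_assoc]

theorem sums_exch_low (hd : 2 ≤ d) (hl2 : 2 ≤ l) (hln : l ≤ n - 1) {s : Fin n}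
    (hs : l ≤ (s : ℕ)) {k : ℕ} :
    ∀ {m : Mon n}, m ∈ sums (lexSeg n l d a) k → k < lowDeg l m →
      ∃ i, i < s ∧ ∃ m' ∈ sums (lexSeg n l d a) k,
        m' + Finsupp.single i 1 = m + Finsupp.single s 1 := by
  induction k with
  | zero => rintro m rfl h; simp [lowDeg] at h
  | succ k ih =>
    rintro m ⟨w, hw, p, hp, rfl⟩ h
    by_cases hw2 : 2 ≤ lowDeg l w
    · obtain ⟨i, hi, hip⟩ := lowDeg_pos (l := l) (m := w) (by omega)
      obtain ⟨w', he⟩ := exch_exists w i s hip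
      have his : i < s := by rw [Fin.lt_def]; omega
      refine ⟨i, his, w' + p, ⟨w', lexSeg_exch hd hl2 hln hw his he (by tauto), p, hp, rfl⟩, ?_⟩
      rw [add_right_comm, he, add_right_comm]
    · rw [lowDeg_add] at h
      obtain ⟨i, his, p', hp', he⟩ := ih hp (by omega)
      refine ⟨i, his, w + p', ⟨w, hw, p', hp', rfl⟩, ?_⟩
      rw [add_assoc, he, add_assoc]

/-- The exchange property behind linear quotients. -/
theorem key_exch (hd : 2 ≤ d) (hl2 : 2 ≤ l) (hln : l ≤ n - 1) {k : ℕ} {m z : Mon n}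
    (hm : m ∈ sums (lexSeg n l d a) k) (hz : z ∈ sums (lexSeg n l d a) k) {s : Fin n}
    (hgt : ∀ i, s < i → z i = m i) (hs : m s < z s) :
    ∃ i, i < s ∧ ∃ m' ∈ sums (lexSeg n l d a) k,
        m' + Finsupp.single i 1 = m + Finsupp.single s 1 := by
  have hdeg : ∑ i, m i = ∑ i, z i := by
    rw [← deg_eq, ← deg_eq, sums_deg hm, sums_deg hz]
  by_cases hsl : (s : ℕ) < l
  · have : ∃ i, i < s ∧ 0 < m i := by
      by_contra! hc
      have : ∑ i, m i < ∑ i, z i := by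
        apply Finset.sum_lt_sum _ ⟨s, Finset.mem_univ _, hs⟩
        intro i _
        rcases lt_trichotomy i s with h | h | h
        · have := hc i h
          omega
        · subst h; exact hs.le
        · exact (hgt i h).ge
      omega
    obtain ⟨i, his, hi⟩ := this
    exact ⟨i, his, sums_exch hd hl2 hln his (Or.inl hsl) hm hi⟩
  · by_cases hlow : k < lowDeg l m
    · exact sums_exch_low hd hl2 hln (by omega) hm hlow
    · have hzl := sums_low hd hl2 hln hz
      have : ∃ i : Fin n, i < s ∧ l ≤ (i : ℕ) ∧ 0 < m i := by
        by_contra! hc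
        have hsplit : ∀ x : Mon n, ∑ i, x i
            = lowDeg l x + ∑ i : Fin n, if (i : ℕ) < l then 0 else x i := by
          intro x
          unfold lowDeg
          rw [← Finset.sum_add_distrib]
          apply Finset.sum_congr rfl
          intro i _
          split_ifs <;> simp
        have : (∑ i : Fin n, if (i : ℕ) < l then 0 else m i)
            < ∑ i : Fin n, if (i : ℕ) < l then 0 else z i := by
          apply Finset.sum_lt_sum _ ⟨s, Finset.mem_univ _, by simpa [hsl] using hs⟩
          intro i _
          split_ifs with hil
          · exact le_rfl
          rcases lt_trichotomy i s with h | h | h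
          · have := hc i h (by omega)
            omega
          · subst h; exact hs.le
          · exact (hgt i h).ge
        have h1 := hsplit m
        have h2 := hsplit z
        omega
      obtain ⟨i, his, hil, hi⟩ := this
      exact ⟨i, his, sums_exch hd hl2 hln his (Or.inr hil) hm hi⟩

theorem pow_eq (K : Type*) [Field K] (k : ℕ) : (lexIdeal n l d a K) ^ k
    = Ideal.span ((fun w => monomial w (1 : K)) '' sums (lexSeg n l d a) k) := by
  induction k with
  | zero => simp [sums]
  | succ k ih =>
    rw [pow_succ', ih, lexIdeal, Ideal.span_mul_span']
    congr 1
    ext p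
    constructor
    · rintro ⟨_, ⟨w, hw, rfl⟩, _, ⟨q, hq, rfl⟩, rfl⟩
      exact ⟨w + q, ⟨w, hw, q, hq, rfl⟩, by simp [monomial_mul]⟩
    · rintro ⟨_, ⟨w, hw, q, hq, rfl⟩, rfl⟩
      exact ⟨_, ⟨w, hw, rfl⟩, _, ⟨q, hq, rfl⟩, by simp [monomial_mul]⟩

theorem monomial_mem_span (K : Type*) [Field K] (S : Set (Mon n)) (m : Mon n) :
    monomial m (1 : K) ∈ Ideal.span ((fun w => monomial w (1 : K)) '' S) ↔ ∃ p ∈ S, p ≤ m := by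
  classical
  rw [mem_ideal_span_monomial_image]
  simp [support_monomial]

theorem minGens_eq (K : Type*) [Field K] (k : ℕ) :
    minGens K ((lexIdeal n l d a K) ^ k) = sums (lexSeg n l d a) k := by
  ext m
  simp only [minGens, Set.mem_setOf_eq, pow_eq, monomial_mem_span]
  constructor
  · rintro ⟨⟨p, hp, hpm⟩, h⟩
    by_cases he : p = m
    · exact he ▸ hp
    exfalso
    have : ∃ i, p i ≠ m i := by
      by_contra! hc
      exact he (Finsupp.ext hc)
    obtain ⟨i, hi⟩ := this
    have hi' := hpm i
    refine h i (by rw [Finsupp.mem_support_iff]; omega) ⟨p, hp, fun t => ?_⟩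
    have ht := hpm t
    rw [Finsupp.tsub_apply, Finsupp.single_apply]
    split_ifs with hit
    · subst hit; omega
    · omega
  · intro hm
    refine ⟨⟨m, hm, le_rfl⟩, ?_⟩
    rintro i hi ⟨p, hp, hpm⟩
    have h1 : m - Finsupp.single i 1 + Finsupp.single i 1 = m := by
      apply tsub_add_cancel_of_le
      rw [Finsupp.single_le_iff]
      rw [Finsupp.mem_support_iff] at hi
      omega
    have h2 := congrArg deg h1
    rw [deg_add, deg_single, sums_deg hm, ← sums_deg hp, deg_eq, deg_eq] at h2
    have h3 : ∑ t, p t ≤ ∑ t, (m - Finsupp.single i 1 : Mon n) t :=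
      Finset.sum_le_sum fun t _ => hpm t
    omega

end

/-- For every `k ≥ 1`, `I^k` has linear quotients w.r.t. the increasing reverse
lexicographic order: for every `m ∈ G(I^k)`, the colon ideal
`I^k_{<revlex m} : (m)` is generated by the variables `x_j` with `j ∈ set(m)`. -/
theorem stmt0 (n d l k : ℕ) (K : Type*) [Field K] (a : ℕ → ℕ)
    (hd : 2 ≤ d) (hl2 : 2 ≤ l) (hln : l ≤ n - 1)
    (hsum : ∑ j ∈ Finset.Ico l n, a j = d - 1) (hk : 1 ≤ k) :
    ∀ m ∈ minGens K ((lexIdeal n l d a K) ^ k),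
      Submodule.colon (idealBelow K ((lexIdeal n l d a K) ^ k) m)
          (Ideal.span {monomial m (1 : K)}) =
        Ideal.span { p : MvPolynomial (Fin n) K |
          ∃ j ∈ setOfGen K ((lexIdeal n l d a K) ^ k) m, p = monomial (sing n j) (1 : K) } := by
  intro m hm
  set J := lexIdeal n l d a K ^ k with hJ
  have hset : { p : MvPolynomial (Fin n) K |
      ∃ j ∈ setOfGen K J m, p = monomial (sing n j) (1 : K) }
      = (fun w => monomial w (1 : K)) '' (sing n '' setOfGen K J m) := by
    ext p
    simp [eq_comm]
  apply le_antisymm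
  · intro f hf
    rw [hset, mem_ideal_span_monomial_image]
    intro x hx
    have hf' : f * monomial m (1 : K) ∈ idealBelow K J m := by
      have := Submodule.mem_colon.1 hf (monomial m (1 : K)) (Ideal.subset_span rfl)
      simpa [smul_eq_mul] using this
    rw [idealBelow, mem_ideal_span_monomial_image] at hf'
    obtain ⟨z, ⟨hz, s, hgt, hs⟩, hzle⟩ := hf' (x + m) (by
      rw [mem_support_iff, coeff_mul_monomial, mul_one]
      exact mem_support_iff.1 hx)
    have hm2 := hm
    have hz2 := hz
    rw [hJ, minGens_eq] at hm2 hz2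
    obtain ⟨i, his, m', hm', he⟩ := key_exch hd hl2 hln hm2 hz2 hgt hs
    refine ⟨sing n s, ⟨s, ⟨s.2, ?_⟩, rfl⟩, ?_⟩
    · rw [idealBelow, monomial_mem_span]
      refine ⟨m', ⟨by rw [hJ, minGens_eq]; exact hm', s, ?_, ?_⟩, ?_⟩
      · intro t ht
        have := DFunLike.congr_fun he t
        simpa [Finsupp.single_apply, ht.ne, (his.trans ht).ne] using this
      · have := DFunLike.congr_fun he s
        simp [Finsupp.single_apply, his.ne] at this
        omega
      · rw [sing_eq, ← he]
        exact le_self_add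
    · rw [sing_eq, Finsupp.single_le_iff]
      have := hzle s
      rw [Finsupp.add_apply] at this
      omega
  · rw [Ideal.span_le]
    rintro _ ⟨j, ⟨_, hj⟩, rfl⟩
    refine Submodule.mem_colon.2 fun p hp => ?_
    obtain ⟨q, rfl⟩ := Ideal.mem_span_singleton'.1 hp
    have : monomial (sing n j) (1 : K) • (q * monomial m (1 : K))
        = q * monomial (m + sing n j) (1 : K) := by
      rw [smul_eq_mul, mul_left_comm, monomial_mul, mul_one, add_comm]
    rw [this]
    exact Ideal.mul_mem_left _ _ hj
end

section
/- If m ∈ G(I^k) is a monomial and s ∈ set(m), then s > min(m). -/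
open MvPolynomial Finset

theorem pow_eq_span (n d : ℕ) (K : Type*) [Field K] (S : Set (Mon n))
    (hS : ∀ w ∈ S, w.degree = d) (k : ℕ) :
    ∃ T : Set (Mon n), (∀ w ∈ T, w.degree = d * k) ∧
      (Ideal.span ((fun w => monomial w (1 : K)) '' S)) ^ k =
        Ideal.span ((fun w => monomial w (1 : K)) '' T) := by
  induction k with
  | zero =>
    refine ⟨{0}, by simp, ?_⟩
    rw [pow_zero, Set.image_singleton, Ideal.one_eq_top]
    symm
    rw [Ideal.eq_top_iff_one]
    exact Ideal.subset_span (by simp)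
  | succ k ih =>
    obtain ⟨T, hT, hTe⟩ := ih
    refine ⟨{w | ∃ x ∈ T, ∃ y ∈ S, x + y = w}, ?_, ?_⟩
    · rintro w ⟨x, hx, y, hy, rfl⟩
      rw [map_add, hT x hx, hS y hy]
      ring
    · rw [pow_succ, hTe, Ideal.span_mul_span']
      congr 1
      ext p
      simp only [Set.mem_mul, Set.mem_image, Set.mem_setOf_eq]
      constructor
      · rintro ⟨_, ⟨x, hx, rfl⟩, _, ⟨y, hy, rfl⟩, rfl⟩
        exact ⟨x + y, ⟨x, hx, y, hy, rfl⟩, by simp [monomial_mul]⟩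
      · rintro ⟨_, ⟨x, hx, y, hy, rfl⟩, rfl⟩
        exact ⟨_, ⟨x, hx, rfl⟩, _, ⟨y, hy, rfl⟩, by simp [monomial_mul]⟩

theorem monomial_mem_span_iff {n : ℕ} (K : Type*) [Field K] (T : Set (Mon n)) (m : Mon n) :
    monomial m (1 : K) ∈ Ideal.span ((fun w => monomial w (1 : K)) '' T) ↔
      ∃ w ∈ T, w ≤ m := by
  classical
  rw [mem_ideal_span_monomial_image]
  simp [support_monomial]

theorem minGens_sub {n : ℕ} (K : Type*) [Field K] (T : Set (Mon n)) (m : Mon n)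
    (hm : m ∈ minGens K (Ideal.span ((fun w => monomial w (1 : K)) '' T))) : m ∈ T := by
  obtain ⟨h1, h2⟩ := hm
  obtain ⟨w, hw, hle⟩ := (monomial_mem_span_iff K T m).1 h1
  by_cases h : w = m
  · exact h ▸ hw
  · exfalso
    have : ∃ i, w i < m i := by
      by_contra! hc
      exact h (le_antisymm hle hc)
    obtain ⟨i, hi⟩ := this
    refine h2 i (by simp; omega) ((monomial_mem_span_iff K T _).2 ⟨w, hw, ?_⟩)
    intro j
    have := hle j
    by_cases hj : i = j
    · subst hj
      simp; omega
    · simpa [Finsupp.single_apply, hj] using this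

/-- If `m ∈ G(I^k)` and `s ∈ set(m)`, then `s > min(m)`. -/
theorem stmt2 (n d l k : ℕ) (K : Type*) [Field K] (a : ℕ → ℕ)
    (hd : 2 ≤ d) (hl2 : 2 ≤ l) (hln : l ≤ n - 1)
    (hsum : ∑ j ∈ Finset.Ico l n, a j = d - 1) (hk : 1 ≤ k) :
    ∀ m ∈ minGens K ((lexIdeal n l d a K) ^ k),
      ∀ s ∈ setOfGen K ((lexIdeal n l d a K) ^ k) m, minIdx m < s := by
  intro m hm s hs
  obtain ⟨T, hT, hTe⟩ := pow_eq_span n d K (lexSeg n l d a) (fun w hw => hw.1) k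
  obtain ⟨hsn, hs⟩ := hs
  unfold idealBelow at hs
  obtain ⟨z, ⟨hz, p, hp, hpl⟩, hle⟩ := (monomial_mem_span_iff K _ _).1 hs
  unfold lexIdeal at hm hz
  rw [hTe] at hm hz
  have hzd := hT z (minGens_sub K T z hz)
  have hmd := hT m (minGens_sub K T m hm)
  have hle' : ∀ i, z i ≤ m i + if (i : ℕ) = s then 1 else 0 := fun i => hle i
  have hps : (p : ℕ) = s := by
    by_contra hc
    have := hle' p
    simp only [hc, if_false] at this
    omega
  have hex : ∃ t, z t < m t := by
    by_contra! hc
    have hlt : ∑ i, m i < ∑ i, z i :=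
      Finset.sum_lt_sum (fun i _ => hc i) ⟨p, Finset.mem_univ _, hpl⟩
    rw [Finsupp.degree_eq_sum] at hzd hmd
    omega
  obtain ⟨t, ht⟩ := hex
  have htp : t < p := by
    by_contra hc
    rcases (not_lt.1 hc).eq_or_lt with h | h
    · subst h; omega
    · have := hp t h; omega
  have hmin : minIdx m ≤ t := Nat.sInf_le ⟨t.2, by
    have : m t ≠ 0 := by omega
    exact this⟩
  have : (t : ℕ) < p := htp
  omega
end

section
/- If m ∈ G(I^k), then deg(m̄) ≥ k, where m̄ is the part of m supported in the variables x_1,…,x_l. -/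
open MvPolynomial Finset

theorem deg_low_eq {n : ℕ} (l : ℕ) (m : Mon n) :
    deg (lowPart l m) = ∑ i : Fin n, if (i : ℕ) < l then m i else 0 := by
  unfold deg lowPart
  rw [Finsupp.sum_fintype _ _ (fun _ => rfl)]
  simp only [Finsupp.filter_apply]

theorem low_add {n : ℕ} (l : ℕ) (m m' : Mon n) :
    deg (lowPart l (m + m')) = deg (lowPart l m) + deg (lowPart l m') := by
  simp only [deg_low_eq, ← Finset.sum_add_distrib]
  refine Finset.sum_congr rfl fun i _ => ?_
  split_ifs <;> simp

theorem low_mono {n : ℕ} (l : ℕ) {m m' : Mon n} (h : m ≤ m') :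
    deg (lowPart l m) ≤ deg (lowPart l m') := by
  obtain ⟨c, rfl⟩ := exists_add_of_le h
  rw [low_add]
  omega

theorem low_pos {n d l : ℕ} {a : ℕ → ℕ} (hl2 : 2 ≤ l) (hln : l ≤ n - 1) {w : Mon n}
    (hw : w ∈ lexSeg n l d a) : 1 ≤ deg (lowPart l w) := by
  by_contra hcon
  have h0 : deg (lowPart l w) = 0 := by omega
  rw [deg_low_eq, Finset.sum_eq_zero_iff] at h0
  have hz : ∀ i : Fin n, (i : ℕ) < l → w i = 0 := by
    intro i hi
    have := h0 i (Finset.mem_univ i)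
    rwa [if_pos hi] at this
  have hv : vVec n l d ⟨l - 1, by omega⟩ ≠ 0 := by
    simp [vVec, sing]
  have hwl := hz ⟨l - 1, by omega⟩ (by simp; omega)
  obtain ⟨-, h | ⟨i, h1, h2⟩, -⟩ := hw
  · rw [h] at hv
    exact hv hwl
  · by_cases hi : (i : ℕ) < l
    · have := hz i hi
      omega
    · have := h1 ⟨l - 1, by omega⟩ (by rw [Fin.lt_def]; simp; omega)
      rw [this] at hv
      exact hv hwl

theorem pow_le_low {n d l : ℕ} {a : ℕ → ℕ} (K : Type*) [Field K]
    (hl2 : 2 ≤ l) (hln : l ≤ n - 1) (k : ℕ) :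
    (lexIdeal n l d a K) ^ k ≤
      Ideal.span ((fun w => monomial w (1 : K)) '' {w : Mon n | k ≤ deg (lowPart l w)}) := by
  induction k with
  | zero =>
    have h : (1 : MvPolynomial (Fin n) K) ∈
        Ideal.span ((fun w => monomial w (1 : K)) '' {w : Mon n | 0 ≤ deg (lowPart l w)}) :=
      Ideal.subset_span ⟨0, by simp, rfl⟩
    rw [(Ideal.eq_top_iff_one _).2 h]
    exact le_top
  | succ k ih =>
    rw [pow_succ]
    refine (Ideal.mul_mono_left ih).trans ?_
    unfold lexIdeal
    rw [Ideal.span_mul_span', Ideal.span_le]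
    rintro _ ⟨_, ⟨w, hw, rfl⟩, _, ⟨w', hw', rfl⟩, rfl⟩
    refine Ideal.subset_span ⟨w + w', ?_, ?_⟩
    · have := low_pos hl2 hln hw'
      simp only [Set.mem_setOf_eq] at hw ⊢
      rw [low_add]
      omega
    · simp [monomial_mul]

/-- If `m ∈ G(I^k)`, then `deg m̄ ≥ k`, where `m̄` is the part of `m`
supported in `x_1, …, x_l`. -/
theorem stmt3 (n d l k : ℕ) (K : Type*) [Field K] (a : ℕ → ℕ)
    (hd : 2 ≤ d) (hl2 : 2 ≤ l) (hln : l ≤ n - 1)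
    (hsum : ∑ j ∈ Finset.Ico l n, a j = d - 1) (hk : 1 ≤ k) :
    ∀ m ∈ minGens K ((lexIdeal n l d a K) ^ k), k ≤ deg (lowPart l m) := by
  intro m hm
  have h := pow_le_low K hl2 hln k hm.1
  rw [mem_ideal_span_monomial_image] at h
  obtain ⟨w, hw, hle⟩ := h m (by simp [mem_support_iff])
  exact le_trans hw (low_mono l hle)
end

section
/- Every m ∈ G(I^k) admits a factorization m = m_1·m_2⋯m_k where each m_i belongs to the lexsegment L(u,v). -/
open MvPolynomial Finset

theorem pow_span_monomial {n : ℕ} (K : Type*) [Field K] (A : Set (Mon n)) (k : ℕ) :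
    (Ideal.span ((fun w => monomial w (1 : K)) '' A)) ^ k =
      Ideal.span ((fun w => monomial w (1 : K)) ''
        {m : Mon n | ∃ f : Fin k → Mon n, (∀ i, f i ∈ A) ∧ m = ∑ i, f i}) := by
  induction k with
  | zero =>
    rw [pow_zero, Ideal.one_eq_top]
    symm
    rw [Ideal.eq_top_iff_one]
    apply Ideal.subset_span
    exact ⟨0, ⟨fun i => i.elim0, fun i => i.elim0, by simp⟩, rfl⟩
  | succ k ih =>
    rw [pow_succ', ih, Ideal.span_mul_span']
    congr 1
    ext p
    rw [Set.mem_mul]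
    constructor
    · rintro ⟨_, ⟨w, hw, rfl⟩, _, ⟨_, ⟨f, hf, rfl⟩, rfl⟩, rfl⟩
      refine ⟨w + ∑ i, f i, ⟨Fin.cons w f, ?_, ?_⟩, ?_⟩
      · intro i
        refine Fin.cases ?_ ?_ i
        · simpa using hw
        · intro j
          simpa using hf j
      · rw [Fin.sum_univ_succ]
        simp
      · simp [monomial_mul]
    · rintro ⟨_, ⟨f, hf, rfl⟩, rfl⟩
      refine ⟨_, ⟨f 0, hf 0, rfl⟩, _,
        ⟨_, ⟨fun i => f i.succ, fun i => hf _, rfl⟩, rfl⟩, ?_⟩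
      simp only [monomial_mul, one_mul]
      rw [Fin.sum_univ_succ]

/-- Every `m ∈ G(I^k)` factors as `m = m_1 ⋯ m_k` with each `m_i ∈ L(u,v)`
(products of monomials correspond to sums of exponent vectors). -/
theorem stmt4 (n d l k : ℕ) (K : Type*) [Field K] (a : ℕ → ℕ)
    (hd : 2 ≤ d) (hl2 : 2 ≤ l) (hln : l ≤ n - 1)
    (hsum : ∑ j ∈ Finset.Ico l n, a j = d - 1) (hk : 1 ≤ k) :
    ∀ m ∈ minGens K ((lexIdeal n l d a K) ^ k),
      ∃ f : Fin k → Mon n, (∀ i, f i ∈ lexSeg n l d a) ∧ m = ∑ i, f i := by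
  intro m hm
  obtain ⟨hm1, hm2⟩ := hm
  have key : ∀ w : Mon n, monomial w (1 : K) ∈ (lexIdeal n l d a K) ^ k ↔
      ∃ g ∈ {m : Mon n | ∃ f : Fin k → Mon n,
        (∀ i, f i ∈ lexSeg n l d a) ∧ m = ∑ i, f i}, g ≤ w := by
    intro w
    rw [lexIdeal, pow_span_monomial, mem_ideal_span_monomial_image]
    classical
    simp [support_monomial]
  obtain ⟨g, hg, hgm⟩ := (key m).1 hm1
  by_cases h : g = m
  · subst h
    exact hg
  · exfalso
    have : ∃ i, g i < m i := by
      by_contra hcon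
      push Not at hcon
      exact h (le_antisymm hgm hcon)
    obtain ⟨i, hi⟩ := this
    refine hm2 i (by rw [Finsupp.mem_support_iff]; omega) ((key _).2 ⟨g, hg, ?_⟩)
    intro j
    have hj := hgm j
    rw [Finsupp.tsub_apply]
    by_cases hij : i = j
    · subst hij
      rw [Finsupp.single_eq_same]
      omega
    · rw [Finsupp.single_apply, if_neg hij]
      simpa using hj
end
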